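/- Let N = 1, T > 0, α > 0, and let f : ℝ × (0,T) → ℝ be non-negative, bounded and measurable. Let s_0 ∈ ℝ. Then there exists no pair (u, s) with s : [0,T) → ℝ continuous on [0,T), continuously differentiable on (0,T), s(0) = s_0, and u a non-negative bounded classical solution of the heat equation ∂_t u − ∂_x² u = f(x,t) on the moving domain {(x,t) : x > s(t), 0 < t < T}, continuous together with ∂_x u up to the free boundary x = s(t), satisfying the boundary conditions u(s(t),t) = 0 and ∂_x u(s(t),t) = α for 0 < t < T, and continuous up to t = 0 with initial value u(·,0) ≡ 0 on [s_0,∞). -/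

import Mathlib

set_option autoImplicit false

open Set Filter

lemma npo_second (g g' : ℝ → ℝ) (m x : ℝ) (h : ∀ᶠ y in nhds x, HasDerivAt g (g' y) y)
    (h2 : HasDerivAt g' m x) (hmax : IsLocalMax g x) : m ≤ 0 := by
  by_contra hm
  push Not at hm
  have hd : deriv g =ᶠ[nhds x] g' := h.mono fun y hy => hy.deriv
  have h0 : deriv g x = 0 := hmax.deriv_eq_zero
  have hdd : deriv (deriv g) x = m := by rw [hd.deriv_eq]; exact h2.deriv
  have hmin : IsLocalMin g x :=
    isLocalMin_of_deriv_deriv_pos (by rw [hdd]; exact hm) h0 h.self_of_nhds.continuousAt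
  have hc : g =ᶠ[nhds x] fun _ => g x := by
    filter_upwards [hmax, hmin] with y h1 h2
    exact le_antisymm h1 h2
  have hdc : deriv g =ᶠ[nhds x] fun _ => 0 := by
    have := hc.deriv
    simpa using this
  have : deriv (deriv g) x = 0 := by rw [hdc.deriv_eq]; simp
  linarith

lemma npo_time (g : ℝ → ℝ) (m t : ℝ) (h : HasDerivAt g m t)
    (hmax : ∀ᶠ y in nhdsWithin t (Iio t), g y ≤ g t) : 0 ≤ m := by
  have h1 : Tendsto (slope g t) (nhdsWithin t (Iio t)) (nhds m) :=
    (hasDerivWithinAt_iff_tendsto_slope' (by simp)).1 h.hasDerivWithinAt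
  refine ge_of_tendsto h1 ?_
  filter_upwards [hmax, self_mem_nhdsWithin] with y hy hlt
  rw [slope_def_field]
  have : y < t := hlt
  exact div_nonneg_of_nonpos (by linarith) (by linarith)

lemma npo_compact (lo hi : ℝ → ℝ) (τ : ℝ) (hlo : ContinuousOn lo (Icc 0 τ))
    (hhi : ContinuousOn hi (Icc 0 τ)) :
    IsCompact {p : ℝ × ℝ | p.2 ∈ Icc 0 τ ∧ lo p.2 ≤ p.1 ∧ p.1 ≤ hi p.2} := by
  obtain ⟨a, ha⟩ := (isCompact_Icc.image_of_continuousOn hlo).bddBelow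
  obtain ⟨b, hb⟩ := (isCompact_Icc.image_of_continuousOn hhi).bddAbove
  have hbox : IsCompact (Icc a b ×ˢ Icc (0:ℝ) τ) := isCompact_Icc.prod isCompact_Icc
  refine hbox.of_isClosed_subset ?_ ?_
  · have hS : IsClosed {p : ℝ × ℝ | p.2 ∈ Icc 0 τ} := isClosed_Icc.preimage continuous_snd
    have c1 : ContinuousOn (fun p : ℝ × ℝ => (p.1 - lo p.2, hi p.2 - p.1))
        {p : ℝ × ℝ | p.2 ∈ Icc 0 τ} := by
      have e1 : ContinuousOn (fun p : ℝ × ℝ => lo p.2) {p : ℝ × ℝ | p.2 ∈ Icc 0 τ} :=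
        hlo.comp continuousOn_snd (fun p hp => hp)
      have e2 : ContinuousOn (fun p : ℝ × ℝ => hi p.2) {p : ℝ × ℝ | p.2 ∈ Icc 0 τ} :=
        hhi.comp continuousOn_snd (fun p hp => hp)
      exact (continuousOn_fst.sub e1).prodMk (e2.sub continuousOn_fst)
    have := c1.preimage_isClosed_of_isClosed hS ((isClosed_Ici (a := (0:ℝ))).prod (isClosed_Ici (a := (0:ℝ))))
    convert this using 1
    ext p
    simp
  · rintro ⟨x, t⟩ ⟨ht, h1, h2⟩
    have := ha (mem_image_of_mem lo ht)
    have := hb (mem_image_of_mem hi ht)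
    simp only [mem_prod, mem_Icc] at *
    exact ⟨⟨by linarith, by linarith⟩, ht⟩

/-- Weak maximum principle for strict subsolutions on a moving interval. -/
lemma npo_max (lo hi : ℝ → ℝ) (τ : ℝ) (hlo : ContinuousOn lo (Icc 0 τ))
    (hhi : ContinuousOn hi (Icc 0 τ)) (w : ℝ → ℝ → ℝ)
    (hw : ContinuousOn (fun p : ℝ × ℝ => w p.1 p.2)
      {p : ℝ × ℝ | p.2 ∈ Icc 0 τ ∧ lo p.2 ≤ p.1 ∧ p.1 ≤ hi p.2})
    (h0 : ∀ x, lo 0 ≤ x → x ≤ hi 0 → w x 0 ≤ 0)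
    (hl : ∀ t, 0 < t → t ≤ τ → lo t ≤ hi t → w (lo t) t ≤ 0)
    (hr : ∀ t, 0 < t → t ≤ τ → lo t ≤ hi t → w (hi t) t ≤ 0)
    (hin : ∀ t, 0 < t → t ≤ τ → ∀ x, lo t < x → x < hi t →
      ∃ (wx : ℝ → ℝ) (wxx wt : ℝ), (∀ y ∈ Ioo (lo t) (hi t), HasDerivAt (fun ξ => w ξ t) (wx y) y) ∧
        HasDerivAt wx wxx x ∧ HasDerivAt (fun r => w x r) wt t ∧ wt < wxx)
    (x t : ℝ) (ht : t ∈ Icc 0 τ) (hx1 : lo t ≤ x) (hx2 : x ≤ hi t) : w x t ≤ 0 := by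
  obtain ⟨⟨x1, t1⟩, ⟨ht1, ha, hb⟩, hm⟩ := (npo_compact lo hi τ hlo hhi).exists_isMaxOn
    ⟨(x, t), ht, hx1, hx2⟩ hw
  have hmax : ∀ y r, r ∈ Icc 0 τ → lo r ≤ y → y ≤ hi r → w y r ≤ w x1 t1 :=
    fun y r h1 h2 h3 => hm (show (y, r) ∈ _ from ⟨h1, h2, h3⟩)
  simp only at ht1 ha hb
  refine (hmax x t ht hx1 hx2).trans ?_
  rcases ht1.1.eq_or_lt with h | htpos
  · subst h; exact h0 _ ha hb
  rcases ha.eq_or_lt with h | hlt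
  · subst h; exact hl _ htpos ht1.2 hb
  rcases hb.eq_or_lt with h | hgt
  · subst h; exact hr _ htpos ht1.2 ha
  exfalso
  obtain ⟨wx, wxx, wt, d1, d2, d3, hlt'⟩ := hin t1 htpos ht1.2 x1 hlt hgt
  have hn : Ioo (lo t1) (hi t1) ∈ nhds x1 := Ioo_mem_nhds hlt hgt
  have e1 : wxx ≤ 0 := by
    refine npo_second (fun ξ => w ξ t1) wx wxx x1 ?_ d2 ?_
    · filter_upwards [hn] with y hy using d1 y hy
    · filter_upwards [hn] with y hy using hmax y t1 ht1 hy.1.le hy.2.le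
  have hsub : Ioo 0 t1 ∈ nhdsWithin t1 (Iio t1) := Ioo_mem_nhdsLT htpos
  have hle : nhdsWithin t1 (Iio t1) ≤ nhdsWithin t1 (Icc 0 τ) := by
    refine nhdsWithin_le_of_mem ?_
    filter_upwards [hsub] with r hr using ⟨hr.1.le, hr.2.le.trans ht1.2⟩
  have e2 : 0 ≤ wt := by
    refine npo_time (fun r => w x1 r) wt t1 d3 ?_
    have f1 := ((hlo t1 ht1).mono_left hle).eventually (gt_mem_nhds hlt)
    have f2 := ((hhi t1 ht1).mono_left hle).eventually (lt_mem_nhds hgt)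
    filter_upwards [hsub, f1, f2] with r hr g1 g2
    exact hmax x1 r ⟨hr.1.le, hr.2.le.trans ht1.2⟩ g1.le g2.le
  linarith

/-- **No formation of a new phase, one-dimensional case.**
For `N = 1`, `T > 0`, `α > 0`, a non-negative bounded measurable heat source `f`
and any initial free boundary location `s₀`, there is no pair `(u, s)` such that
`s` is continuous on `[0,T)`, continuously differentiable on `(0,T)` with `s 0 = s₀`,
and `u` is a non-negative bounded classical solution of `∂ₜu - ∂ₓ²u = f` on the moving
domain `{x > s t, 0 < t < T}`, continuous together with `∂ₓu` up to the free boundary,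
with `u(s t, t) = 0`, `∂ₓu(s t, t) = α`, continuous up to `t = 0` with `u(·,0) ≡ 0`.
Here `ux` and `uxx` are the (existentially quantified) spatial derivatives of `u`. -/
theorem no_new_phase_one_dimensional
    (T α : ℝ) (hT : 0 < T) (hα : 0 < α)
    (f : ℝ → ℝ → ℝ)
    (hf_nonneg : ∀ x : ℝ, ∀ t ∈ Ioo 0 T, 0 ≤ f x t)
    (hf_bdd : ∃ M : ℝ, ∀ x : ℝ, ∀ t ∈ Ioo 0 T, f x t ≤ M)
    (hf_meas : Measurable fun p : ℝ × ℝ => f p.1 p.2)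
    (s₀ : ℝ) :
    ¬ ∃ (u : ℝ → ℝ → ℝ) (s : ℝ → ℝ) (ux uxx : ℝ → ℝ → ℝ),
      -- regularity of the free boundary
      ContinuousOn s (Ico 0 T) ∧
      (∀ t ∈ Ioo 0 T, DifferentiableAt ℝ s t) ∧
      ContinuousOn (deriv s) (Ioo 0 T) ∧
      s 0 = s₀ ∧
      -- u is a classical solution of the heat equation ∂ₜ u - ∂ₓ² u = f in the moving domain
      (∀ t ∈ Ioo 0 T, ∀ x : ℝ, s t < x →
        HasDerivAt (fun ξ => u ξ t) (ux x t) x ∧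
        HasDerivAt (fun ξ => ux ξ t) (uxx x t) x ∧
        HasDerivAt (fun τ => u x τ) (uxx x t + f x t) t) ∧
      -- u is non-negative on the closed moving domain
      (∀ t ∈ Ico 0 T, ∀ x : ℝ, s t ≤ x → 0 ≤ u x t) ∧
      -- u is bounded
      (∃ M : ℝ, ∀ t ∈ Ico 0 T, ∀ x : ℝ, s t ≤ x → u x t ≤ M) ∧
      -- u is continuous up to the free boundary and up to t = 0
      ContinuousOn (fun p : ℝ × ℝ => u p.1 p.2)
        {p : ℝ × ℝ | p.2 ∈ Ico 0 T ∧ s p.2 ≤ p.1} ∧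
      -- ∂ₓ u is continuous up to the free boundary
      ContinuousOn (fun p : ℝ × ℝ => ux p.1 p.2)
        {p : ℝ × ℝ | p.2 ∈ Ioo 0 T ∧ s p.2 ≤ p.1} ∧
      -- Dirichlet boundary condition
      (∀ t ∈ Ioo 0 T, u (s t) t = 0) ∧
      -- fixed normal derivative (Neumann) condition ∂u/∂ν = -α, i.e. ∂ₓu = α at x = s t
      (∀ t ∈ Ioo 0 T, ux (s t) t = α) ∧
      -- zero initial value on [s₀, ∞)
      (∀ x : ℝ, s₀ ≤ x → u x 0 = 0) := by
  rintro ⟨u, s, ux, uxx, hs, hsd, -, hs0, hpde, hnn, ⟨B₀, hB₀⟩, hu, hux, hD, hN, hI⟩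
  obtain ⟨M₀, hM₀⟩ := hf_bdd
  obtain ⟨B, hBdef⟩ : ∃ B, B = max B₀ 0 := ⟨_, rfl⟩
  obtain ⟨M, hMdef⟩ : ∃ M, M = max M₀ 0 := ⟨_, rfl⟩
  have hB0 : 0 ≤ B := hBdef ▸ le_max_right _ _
  have hM0 : 0 ≤ M := hMdef ▸ le_max_right _ _
  have hB : ∀ t ∈ Ico 0 T, ∀ x : ℝ, s t ≤ x → u x t ≤ B := fun t ht x hx =>
    (hB₀ t ht x hx).trans (hBdef ▸ le_max_left _ _)
  have hM : ∀ x : ℝ, ∀ t ∈ Ioo 0 T, f x t ≤ M := fun x t ht =>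
    (hM₀ x t ht).trans (hMdef ▸ le_max_left _ _)
  clear hBdef hMdef hB₀ hM₀
  obtain ⟨Λ, hΛ⟩ : ∃ Λ, Λ = M + 2 * B + 1 := ⟨_, rfl⟩
  have hΛpos : 0 < Λ := by linarith
  -- linear-in-time bound
  have hlin : ∀ t₀ ∈ Ioo 0 T, ∀ x₀, s t₀ ≤ x₀ → u x₀ t₀ ≤ Λ * t₀ := by
    intro t₀ ht₀ x₀ hx₀
    have hsub : Icc 0 t₀ ⊆ Ico 0 T := fun r hr => ⟨hr.1, hr.2.trans_lt ht₀.2⟩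
    have key := npo_max (fun t => max (s t) (x₀ - 1)) (fun _ => x₀ + 1) t₀
      ((hs.mono hsub).sup continuousOn_const) continuousOn_const
      (fun x t => u x t - (Λ * t + B * (x - x₀) ^ 2)) ?_ ?_ ?_ ?_ ?_ x₀ t₀ ⟨ht₀.1.le, le_rfl⟩
      (max_le hx₀ (by linarith)) (by linarith)
    · simp at key; linarith
    · refine ContinuousOn.sub (hu.mono ?_) (by fun_prop)
      rintro ⟨x, t⟩ ⟨h1, h2, h3⟩
      exact ⟨hsub h1, (le_max_left _ _).trans h2⟩
    · intro x h1 h2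
      have : u x 0 = 0 := hI x (hs0 ▸ (le_max_left _ _).trans h1)
      have := mul_nonneg hB0 (sq_nonneg (x - x₀))
      linarith
    · intro t h1 h2 h3
      have htT : t ∈ Ioo 0 T := ⟨h1, h2.trans_lt ht₀.2⟩
      have hΛt : 0 < Λ * t := mul_pos hΛpos h1
      rcases le_total (s t) (x₀ - 1) with h | h
      · rw [max_eq_right h]
        have := hB t ⟨h1.le, htT.2⟩ _ h
        nlinarith
      · rw [max_eq_left h, hD t htT]
        have := mul_nonneg hB0 (sq_nonneg (s t - x₀))
        linarith
    · intro t h1 h2 h3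
      have htT : t ∈ Ioo 0 T := ⟨h1, h2.trans_lt ht₀.2⟩
      have hΛt : 0 < Λ * t := mul_pos hΛpos h1
      have := hB t ⟨h1.le, htT.2⟩ _ ((le_max_left _ _).trans h3)
      nlinarith
    · intro t h1 h2 x h3 h4
      have htT : t ∈ Ioo 0 T := ⟨h1, h2.trans_lt ht₀.2⟩
      obtain ⟨-, d2, d3⟩ := hpde t htT x ((le_max_left _ _).trans_lt h3)
      refine ⟨fun y => ux y t - 2 * B * (y - x₀), uxx x t - 2 * B, uxx x t + f x t - Λ,
        ?_, ?_, ?_, ?_⟩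
      · intro y hy
        obtain ⟨d1, -, -⟩ := hpde t htT y ((le_max_left _ _).trans_lt hy.1)
        have := d1.sub (((((hasDerivAt_id y).sub_const x₀).pow 2).const_mul B).const_add (Λ * t))
        refine this.congr_deriv ?_
        simp; ring
      · have := d2.sub (((hasDerivAt_id x).sub_const x₀).const_mul (2 * B))
        refine this.congr_deriv ?_
        simp
      · have := d3.sub (((hasDerivAt_id t).const_mul Λ).add_const (B * (x - x₀) ^ 2))
        refine this.congr_deriv ?_
        simp
      · have := hM x t htT
        linarith
  -- choice of parameters
  obtain ⟨a, ha⟩ : ∃ a, a = α / 2 := ⟨_, rfl⟩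
  have hapos : 0 < a := by linarith
  obtain ⟨δ, hδ⟩ : ∃ δ, δ = a / (16 * Λ) := ⟨_, rfl⟩
  have hδpos : 0 < δ := by rw [hδ]; positivity
  obtain ⟨η, hη, hηs⟩ : ∃ η > 0, ∀ t ∈ Ico 0 T, t < η → s t < s₀ + δ := by
    have := (hs 0 ⟨le_rfl, hT⟩).eventually (gt_mem_nhds (show s 0 < s₀ + δ by linarith))
    obtain ⟨η, hη, h⟩ := Metric.eventually_nhds_iff.1 (eventually_nhdsWithin_iff.1 this)
    refine ⟨η, hη, fun t ht hlt => h ?_ ht⟩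
    rw [Real.dist_eq, sub_zero, abs_of_nonneg ht.1]; exact hlt
  obtain ⟨ρ, hρ⟩ : ∃ ρ, ρ = min η T := ⟨_, rfl⟩
  have hρpos : 0 < ρ := by rw [hρ]; exact lt_min hη hT
  obtain ⟨c, hc⟩ : ∃ c, c = (Λ + 1) / a + a / (Λ * ρ) := ⟨_, rfl⟩
  have hcpos : 0 < c := by rw [hc]; positivity
  have hca : c * a = Λ + 1 + a ^ 2 / (Λ * ρ) := by rw [hc]; field_simp
  have hca1 : Λ + 1 ≤ c * a := by rw [hca]; have : 0 ≤ a ^ 2 / (Λ * ρ) := by positivity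
                                  linarith
  obtain ⟨K, hK⟩ : ∃ K, K = (Λ + 1 + c * a) / 2 := ⟨_, rfl⟩
  have hKpos : 0 < K := by nlinarith
  obtain ⟨τ, hτ⟩ : ∃ τ, τ = a ^ 2 / (8 * K * Λ) := ⟨_, rfl⟩
  have hτpos : 0 < τ := by rw [hτ]; positivity
  have hτρ : τ < ρ := by
    rw [hτ, div_lt_iff₀ (by positivity)]
    have h1 : a ^ 2 / (Λ * ρ) < 2 * K := by rw [hK, hca]; linarith
    rw [div_lt_iff₀ (by positivity)] at h1
    have : 0 < K * (Λ * ρ) := by positivity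
    nlinarith
  have hτT : τ < T := hτρ.trans_le (hρ ▸ min_le_right _ _)
  have hτη : τ < η := hτρ.trans_le (hρ ▸ min_le_left _ _)
  have hcτ : 2 * δ ≤ c * τ := by
    rw [hδ, hτ, ← mul_div_assoc, ← mul_div_assoc, div_le_div_iff₀ (by positivity) (by positivity)]
    have : 2 * K ≤ 2 * (c * a) := by rw [hK]; linarith
    have : 0 ≤ (2 * (c * a) - 2 * K) * (a * Λ) := mul_nonneg (by linarith) (by positivity)
    nlinarith
  obtain ⟨L, hL⟩ : ∃ L, L = a / (2 * K) := ⟨_, rfl⟩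
  have hLpos : 0 < L := by rw [hL]; positivity
  have hKL : 2 * K * L = a := by rw [hL]; field_simp
  have hΛτ : Λ * τ ≤ a * L - K * L ^ 2 := by
    have h1 : Λ * τ = a * L / 4 := by rw [hτ, hL]; field_simp; norm_num
    have h2 : K * L ^ 2 = a * L / 2 := by rw [← hKL]; ring
    have : 0 < a * L := by positivity
    linarith
  have hAnn : ∀ y, 0 ≤ y → y ≤ L → 0 ≤ a * y - K * y ^ 2 := by
    intro y h1 h2
    have : 0 ≤ y * (a - K * y) := mul_nonneg h1 (by nlinarith)
    nlinarith
  -- first time at which the barrier front catches the free boundary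
  have hsub : Icc 0 τ ⊆ Ico 0 T := fun r hr => ⟨hr.1, hr.2.trans_lt hτT⟩
  have hcd : ContinuousOn (fun t => s t - (s₀ - δ + c * t)) (Icc 0 τ) :=
    (hs.mono hsub).sub (by fun_prop)
  have hcl : IsCompact (Icc 0 τ ∩ (fun t => s t - (s₀ - δ + c * t)) ⁻¹' Iic 0) :=
    isCompact_Icc.of_isClosed_subset (hcd.preimage_isClosed_of_isClosed isClosed_Icc isClosed_Iic)
      inter_subset_left
  obtain ⟨r, ⟨hr, hr1⟩, hr2⟩ := hcl.exists_isLeast ⟨τ, ⟨hτpos.le, le_rfl⟩, by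
    have := hηs τ ⟨hτpos.le, hτT⟩ hτη
    simp only [mem_preimage, mem_Iic]; linarith⟩
  simp only [mem_preimage, mem_Iic] at hr1
  have hbefore : ∀ t, 0 ≤ t → t < r → s₀ - δ + c * t < s t := by
    intro t h1 h2
    by_contra h
    have := hr2 (show t ∈ _ from ⟨⟨h1, h2.le.trans hr.2⟩, by
      simp only [mem_preimage, mem_Iic]; linarith⟩)
    linarith
  have hrpos : 0 < r := by
    rcases hr.1.eq_or_lt with h | h
    · rw [← h, hs0] at hr1; linarith
    · exact h
  have hrT : r ∈ Ioo 0 T := ⟨hrpos, hr.2.trans_lt hτT⟩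
  have hreq : s r = s₀ - δ + c * r := by
    refine le_antisymm (by linarith) ?_
    have hle : nhdsWithin r (Iio r) ≤ nhdsWithin r (Icc 0 τ) := by
      refine nhdsWithin_le_of_mem ?_
      filter_upwards [Ioo_mem_nhdsLT hrpos] with q hq using ⟨hq.1.le, hq.2.le.trans hr.2⟩
    have h0 : 0 ≤ s r - (s₀ - δ + c * r) := by
      refine ge_of_tendsto ((hcd r hr).mono_left hle) ?_
      filter_upwards [Ioo_mem_nhdsLT hrpos] with q hq
      have := hbefore q hq.1.le hq.2
      linarith
    linarith
  have hsge : ∀ t, 0 ≤ t → t ≤ r → s₀ - δ + c * t ≤ s t := by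
    intro t h1 h2
    rcases h2.eq_or_lt with h | h
    · rw [h, hreq]
    · exact (hbefore t h1 h).le
  have hsub' : Icc 0 r ⊆ Ico 0 T := fun q hq => ⟨hq.1, hq.2.trans_lt hrT.2⟩
  have hcomp : ∀ x, s r ≤ x → x ≤ s r + L → u x r ≤ a * (x - s r) - K * (x - s r) ^ 2 := by
    intro x hx1 hx2
    have key := npo_max s (fun t => s₀ - δ + c * t + L) r (hs.mono hsub') (by fun_prop)
      (fun x t => u x t - (a * (x - (s₀ - δ + c * t)) - K * (x - (s₀ - δ + c * t)) ^ 2))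
      ?_ ?_ ?_ ?_ ?_ x r ⟨hrpos.le, le_rfl⟩ hx1 (by linarith)
    · simp only [← hreq] at key; linarith
    · refine ContinuousOn.sub (hu.mono ?_) (by fun_prop)
      rintro ⟨x, t⟩ ⟨h1, h2, h3⟩
      exact ⟨hsub' h1, h2⟩
    · intro x h1 h2
      have := hI x (hs0 ▸ h1)
      have := hAnn (x - (s₀ - δ + c * 0)) (by linarith) (by linarith)
      linarith
    · intro t h1 h2 h3
      have := hD t ⟨h1, h2.trans_lt hrT.2⟩
      have := hsge t h1.le h2
      have := hAnn (s t - (s₀ - δ + c * t)) (by linarith) (by linarith)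
      linarith
    · intro t h1 h2 h3
      have h4 := hlin t ⟨h1, h2.trans_lt hrT.2⟩ _ h3
      have h5 : Λ * t ≤ Λ * τ := mul_le_mul_of_nonneg_left (h2.trans hr.2) hΛpos.le
      simp only [add_sub_cancel_left] at *
      linarith
    · intro t h1 h2 x h3 h4
      have htT : t ∈ Ioo 0 T := ⟨h1, h2.trans_lt hrT.2⟩
      obtain ⟨-, d2, d3⟩ := hpde t htT x h3
      refine ⟨fun y => ux y t - (a - 2 * K * (y - (s₀ - δ + c * t))), uxx x t + 2 * K,
        uxx x t + f x t + c * (a - 2 * K * (x - (s₀ - δ + c * t))), ?_, ?_, ?_, ?_⟩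
      · intro y hy
        obtain ⟨d1, -, -⟩ := hpde t htT y hy.1
        have e := (hasDerivAt_id y).sub_const (s₀ - δ + c * t)
        refine (d1.sub ((e.const_mul a).sub ((e.pow 2).const_mul K))).congr_deriv ?_
        simp; ring
      · have e := (hasDerivAt_id x).sub_const (s₀ - δ + c * t)
        refine (d2.sub ((e.const_mul (2 * K)).const_sub a)).congr_deriv ?_
        simp
      · have e := (((hasDerivAt_id t).const_mul c).const_add (s₀ - δ)).const_sub x
        refine (d3.sub ((e.const_mul a).sub ((e.pow 2).const_mul K))).congr_deriv ?_
        simp; ring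
      · have h5 := hM x t htT
        have h6 := hsge t h1.le h2
        have h7 : 0 ≤ c * (2 * K * (x - (s₀ - δ + c * t))) :=
          mul_nonneg hcpos.le (mul_nonneg (by linarith) (by linarith))
        have h8 : 2 * K = Λ + 1 + c * a := by rw [hK]; ring
        rw [mul_sub]
        linarith
  -- contradiction with the slope condition at the contact point
  have hev : ∀ᶠ x in nhdsWithin (s r) (Ici (s r)), a < ux x r := by
    have h1 : ContinuousWithinAt (fun x => ux x r) (Ici (s r)) (s r) := by
      have := hux (s r, r) ⟨hrT, le_rfl⟩
      exact ContinuousWithinAt.comp (f := fun x : ℝ => (x, r)) this (by fun_prop)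
        (fun x hx => ⟨hrT, hx⟩)
    exact h1.eventually (lt_mem_nhds (by simp only [hN r hrT]; linarith))
  obtain ⟨z, hz, hz2⟩ := (mem_nhdsGE_iff_exists_Ico_subset).1 hev
  obtain ⟨x, hx1, hx2⟩ := exists_between (lt_min (show s r < z from hz) (show s r < s r + L by linarith))
  have hcu : ContinuousOn (fun ξ => u ξ r) (Icc (s r) x) :=
    hu.comp (f := fun ξ : ℝ => (ξ, r)) (by fun_prop) (fun ξ hξ => ⟨⟨hrpos.le, hrT.2⟩, hξ.1⟩)
  obtain ⟨ξ, hξ, hξe⟩ := exists_hasDerivAt_eq_slope (fun ξ => u ξ r) (fun ξ => ux ξ r) hx1 hcu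
    (fun ξ hξ => (hpde r hrT ξ hξ.1).1)
  have h1 : a < ux ξ r := hz2 ⟨hξ.1.le, hξ.2.trans (hx2.trans_le (min_le_left _ _))⟩
  have h2 := hcomp x hx1.le (hx2.le.trans (min_le_right _ _))
  simp only [hD r hrT] at hξe
  rw [hξe, lt_div_iff₀ (by linarith)] at h1
  have := mul_nonneg hKpos.le (sq_nonneg (x - s r))
  linarith
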